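/- Let K be an integer with K ≥ −1, set m := 2(K+3), and let n₁, n₂ be positive integers with n₁ < m, n₂ < m and n₁ − n₂ odd. Let τ ∈ ℍ and z₁, z₂, t ∈ ℂ with R(τ, z₁, z₂, t) ≠ 0. Then ch_{n₁,n₂}(τ+1, z₁, z₂, t) = −e^{πi/6} · e^{πi(n₁²+n₂²)/(4(K+3))} · ch_{n₁,n₂}(τ, z₁, z₂, t). -/

import Mathlib

noncomputable section

open Complex Real UpperHalfPlane

/-- The Jacobi theta function
`θ_{j,m}(τ,z) := Σ_{n∈ℤ} e^{2πi m (n + j/(2m)) z} e^{2πi τ m (n + j/(2m))²}`. -/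
def jacobiTh (m j : ℤ) (τ z : ℂ) : ℂ :=
  ∑' n : ℤ,
    Complex.exp (2 * (π : ℂ) * Complex.I * (m : ℂ) * ((n : ℂ) + (j : ℂ) / (2 * (m : ℂ))) * z) *
    Complex.exp (2 * (π : ℂ) * Complex.I * τ * (m : ℂ) * ((n : ℂ) + (j : ℂ) / (2 * (m : ℂ))) ^ 2)

/-- The Gauss sum `γ_m := Σ_{k=0}^{2m−1} e^{πi k²/m}`. -/
def gammaGauss (m : ℤ) : ℂ :=
  ∑ k ∈ Finset.Icc (0 : ℤ) (2 * m - 1),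
    Complex.exp ((π : ℂ) * Complex.I * (k : ℂ) ^ 2 / (m : ℂ))

/-- The numerator function
`A′_{j₁,j₂}(τ,z₁,z₂,t) := e^{2πimt}(θ_{j₁,m} − θ_{−j₁,m})(τ,z₁)(θ_{j₂,m} − θ_{−j₂,m})(τ,z₂)`. -/
def Aprime (m j₁ j₂ : ℤ) (τ z₁ z₂ t : ℂ) : ℂ :=
  Complex.exp (2 * (π : ℂ) * Complex.I * (m : ℂ) * t) *
    (jacobiTh m j₁ τ z₁ - jacobiTh m (-j₁) τ z₁) *
    (jacobiTh m j₂ τ z₂ - jacobiTh m (-j₂) τ z₂)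

/-- `ϑ₁₁(τ,z) := q^{1/8} e^{−πi(z+1/2)} ∏_{n=1}^∞ (1−q^n)(1−e^{2πiz}q^{n−1})(1−e^{−2πiz}q^n)`,
where `q = e^{2πiτ}`. -/
def th11 (τ z : ℂ) : ℂ :=
  Complex.exp (2 * (π : ℂ) * Complex.I * τ / 8) *
  Complex.exp (-(π : ℂ) * Complex.I * (z + 1 / 2)) *
  ∏' n : ℕ,
    ((1 - Complex.exp (2 * (π : ℂ) * Complex.I * τ * ((n : ℂ) + 1))) *
     (1 - Complex.exp (2 * (π : ℂ) * Complex.I * z) *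
        Complex.exp (2 * (π : ℂ) * Complex.I * τ * (n : ℂ))) *
     (1 - Complex.exp (-(2 * (π : ℂ) * Complex.I * z)) *
        Complex.exp (2 * (π : ℂ) * Complex.I * τ * ((n : ℂ) + 1))))

/-- The Dedekind eta function `η(τ) := q^{1/24} ∏_{n=1}^∞ (1−q^n)`, `q = e^{2πiτ}`. -/
def dedekindEta (τ : ℂ) : ℂ :=
  Complex.exp (2 * (π : ℂ) * Complex.I * τ / 24) *
  ∏' n : ℕ, (1 - Complex.exp (2 * (π : ℂ) * Complex.I * τ * ((n : ℂ) + 1)))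

/-- The `C₂⁽¹⁾` Weyl–Kac denominator
`R(τ,z₁,z₂,t) := e^{6πit} η(τ)^{−2} ϑ₁₁(τ,z₁) ϑ₁₁(τ,z₂) ϑ₁₁(τ,z₁−z₂) ϑ₁₁(τ,z₁+z₂)`. -/
def Rden (τ z₁ z₂ t : ℂ) : ℂ :=
  Complex.exp (6 * (π : ℂ) * Complex.I * t) * (dedekindEta τ) ^ (-2 : ℤ) *
    th11 τ z₁ * th11 τ z₂ * th11 τ (z₁ - z₂) * th11 τ (z₁ + z₂)


/-- The normalized character `ch_{j₁,j₂} := A′_{j₁,j₂} / R` (with `m` the theta level). -/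
def chF (m j₁ j₂ : ℤ) (τ z₁ z₂ t : ℂ) : ℂ :=
  Aprime m j₁ j₂ τ z₁ z₂ t / Rden τ z₁ z₂ t


theorem exp_shift (τ : ℂ) (k : ℤ) :
    Complex.exp (2 * (π : ℂ) * Complex.I * (τ + 1) * (k : ℂ)) =
      Complex.exp (2 * (π : ℂ) * Complex.I * τ * (k : ℂ)) := by
  rw [Complex.exp_eq_exp_iff_exists_int]
  exact ⟨k, by ring⟩

theorem exp_shift_nat (τ : ℂ) (k : ℕ) :
    Complex.exp (2 * (π : ℂ) * Complex.I * (τ + 1) * (k : ℂ)) =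
      Complex.exp (2 * (π : ℂ) * Complex.I * τ * (k : ℂ)) := by
  have := exp_shift τ k
  exact_mod_cast this

theorem exp_shift_succ (τ : ℂ) (k : ℕ) :
    Complex.exp (2 * (π : ℂ) * Complex.I * (τ + 1) * ((k : ℂ) + 1)) =
      Complex.exp (2 * (π : ℂ) * Complex.I * τ * ((k : ℂ) + 1)) := by
  have := exp_shift_nat τ (k + 1)
  push_cast at this
  exact this

theorem jacobiTh_shift (m j : ℤ) (hm : (m : ℂ) ≠ 0) (τ z : ℂ) :
    jacobiTh m j (τ + 1) z =
      Complex.exp ((π : ℂ) * Complex.I * (j : ℂ) ^ 2 / (2 * (m : ℂ))) * jacobiTh m j τ z := by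
  unfold jacobiTh
  rw [← tsum_mul_left]
  congr 1
  funext n
  rw [← Complex.exp_add, ← Complex.exp_add, ← Complex.exp_add, Complex.exp_eq_exp_iff_exists_int]
  refine ⟨m * n ^ 2 + n * j, ?_⟩
  push_cast
  field_simp
  ring

theorem th11_shift (τ z : ℂ) :
    th11 (τ + 1) z = Complex.exp ((π : ℂ) * Complex.I / 4) * th11 τ z := by
  unfold th11
  simp only [exp_shift_succ, exp_shift_nat]
  rw [show 2 * (π : ℂ) * Complex.I * (τ + 1) / 8 =
    (π : ℂ) * Complex.I / 4 + 2 * (π : ℂ) * Complex.I * τ / 8 by ring, Complex.exp_add]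
  ring

theorem eta_shift (τ : ℂ) :
    dedekindEta (τ + 1) = Complex.exp ((π : ℂ) * Complex.I / 12) * dedekindEta τ := by
  unfold dedekindEta
  simp only [exp_shift_succ]
  rw [show 2 * (π : ℂ) * Complex.I * (τ + 1) / 24 =
    (π : ℂ) * Complex.I / 12 + 2 * (π : ℂ) * Complex.I * τ / 24 by ring, Complex.exp_add]
  ring

theorem Rden_shift (τ z₁ z₂ t : ℂ) :
    Rden (τ + 1) z₁ z₂ t =
      -(Complex.exp ((π : ℂ) * Complex.I / 6))⁻¹ * Rden τ z₁ z₂ t := by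
  unfold Rden
  have h4 : Complex.exp ((π : ℂ) * Complex.I / 4) ^ 4 = -1 := by
    rw [← Complex.exp_nat_mul, ← Complex.exp_pi_mul_I]
    congr 1
    push_cast
    ring
  have h2 : (Complex.exp ((π : ℂ) * Complex.I / 12)) ^ (-2 : ℤ) =
      (Complex.exp ((π : ℂ) * Complex.I / 6))⁻¹ := by
    rw [← Complex.exp_int_mul, ← Complex.exp_neg]
    congr 1
    push_cast
    ring
  simp only [th11_shift, eta_shift, mul_zpow, h2]
  linear_combination ((Complex.exp ((π : ℂ) * Complex.I / 6))⁻¹ *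
    (Complex.exp (6 * (π : ℂ) * Complex.I * t) * (dedekindEta τ) ^ (-2 : ℤ) *
    th11 τ z₁ * th11 τ z₂ * th11 τ (z₁ - z₂) * th11 τ (z₁ + z₂))) * h4

/-- `T`-transformation of the normalized characters
`ch_{n₁,n₂}` (with `m = 2(K+3)`):
`ch_{n₁,n₂}(τ+1,z₁,z₂,t) = −e^{πi/6} e^{πi(n₁²+n₂²)/(4(K+3))} ch_{n₁,n₂}(τ,z₁,z₂,t)`. -/
theorem statement13 (K : ℤ) (hK : -1 ≤ K) (n₁ n₂ : ℤ)
    (hn₁ : 0 < n₁) (hn₂ : 0 < n₂)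
    (hn₁' : n₁ < 2 * (K + 3)) (hn₂' : n₂ < 2 * (K + 3))
    (hodd : Odd (n₁ - n₂)) (τ : ℍ) (z₁ z₂ t : ℂ)
    (hR : Rden (τ : ℂ) z₁ z₂ t ≠ 0) :
    chF (2 * (K + 3)) n₁ n₂ ((τ : ℂ) + 1) z₁ z₂ t =
    -Complex.exp ((π : ℂ) * Complex.I / 6) *
      Complex.exp ((π : ℂ) * Complex.I * ((n₁ : ℂ) ^ 2 + (n₂ : ℂ) ^ 2) / (4 * ((K : ℂ) + 3))) *
      chF (2 * (K + 3)) n₁ n₂ (τ : ℂ) z₁ z₂ t := by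
  have hm : ((2 * (K + 3) : ℤ) : ℂ) ≠ 0 := by
    exact_mod_cast (by omega : 2 * (K + 3) ≠ 0)
  have he : Complex.exp ((π : ℂ) * Complex.I * ((n₁ : ℂ) ^ 2 + (n₂ : ℂ) ^ 2) /
      (4 * ((K : ℂ) + 3))) =
      Complex.exp ((π : ℂ) * Complex.I * (n₁ : ℂ) ^ 2 / (2 * ((2 * (K + 3) : ℤ) : ℂ))) *
      Complex.exp ((π : ℂ) * Complex.I * (n₂ : ℂ) ^ 2 / (2 * ((2 * (K + 3) : ℤ) : ℂ))) := by
    rw [← Complex.exp_add]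
    congr 1
    push_cast
    ring
  have h6 := Complex.exp_ne_zero ((π : ℂ) * Complex.I / 6)
  rw [he]
  unfold chF
  rw [Rden_shift]
  unfold Aprime
  simp only [jacobiTh_shift _ _ hm, Int.cast_neg, neg_sq]
  field_simp

end
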